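/- arXiv:2308.13033 — 4 statements merged into one kernel-verified Lean document; each statement's English description precedes it below -/
import Mathlib

section
/- Let Ψ = (ψ_{kl}) be an n×n real matrix all of whose row sums and all of whose column sums equal zero. Fix i, j ∈ {1,…,n−1} and suppose that ψ_{kl} = 0 for every k < i and every l ∈ {1,…,n}, that ψ_{il} = 0 for every l < j, and that ψ_{ij} > 0. Then Σ_{k>i} Σ_{l>j} max(ψ_{kl}, 0) ≥ ψ_{ij}. -/
open Matrix Finset

/-- A vanishing sum whose terms before `a` are zero: the terms after `a` sum to `-f a`. -/
theorem sum_filter_gt_eq_neg {ι : Type*} [Fintype ι] [LinearOrder ι] {f : ι → ℝ} {a : ι}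
    (hsum : ∑ x, f x = 0) (hzero : ∀ x, x < a → f x = 0) :
    ∑ x ∈ univ.filter (fun x => a < x), f x = -f a := by
  have hsplit : ∑ x ∈ insert a (univ.filter (fun x => a < x)), f x = ∑ x, f x := by
    refine sum_subset (subset_univ _) fun x _ hx => hzero x ?_
    simp only [mem_insert, mem_filter, mem_univ, true_and, not_or, not_lt] at hx
    exact lt_of_le_of_ne hx.2 hx.1
  rw [sum_insert (by simp), hsum] at hsplit
  linarith

/-- If all row and column sums of `Ψ` vanish, all entries preceding position
`(i, j)` in the row-by-row sweeping order vanish, and `ψ_{ij} > 0`, then the sum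
of the positive parts of the entries in the lower-right block strictly below row
`i` and strictly right of column `j` is at least `ψ_{ij}`. -/
theorem sum_posPart_lowerRight_ge (n : ℕ) (Ψ : Matrix (Fin n) (Fin n) ℝ)
    (hrow : ∀ k, ∑ l, Ψ k l = 0) (hcol : ∀ l, ∑ k, Ψ k l = 0)
    (i j : Fin n) (hi : (i : ℕ) + 1 < n) (hj : (j : ℕ) + 1 < n)
    (hprevRows : ∀ k l : Fin n, k < i → Ψ k l = 0)
    (hprevInRow : ∀ l : Fin n, l < j → Ψ i l = 0)
    (hpos : 0 < Ψ i j) :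
    Ψ i j ≤ ∑ k ∈ univ.filter (fun k => i < k),
      ∑ l ∈ univ.filter (fun l => j < l), max (Ψ k l) 0 := by
  have hblock : ∑ k ∈ univ.filter (fun k => i < k),
      ∑ l ∈ univ.filter (fun l => j < l), Ψ k l = Ψ i j := by
    refine sum_comm.trans ((sum_congr rfl fun l _ =>
      sum_filter_gt_eq_neg (hcol l) fun k hk => hprevRows k l hk).trans ?_)
    rw [sum_neg_distrib, sum_filter_gt_eq_neg (hrow i) hprevInRow, neg_neg]
  rw [← hblock]
  exact sum_le_sum fun k _ => sum_le_sum fun l _ => le_max_left _ _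
end

section
/- Let Ψ = (ψ_{kl}) be an n×n real matrix all of whose row sums and all of whose column sums equal zero. Fix i, j ∈ {1,…,n−1} and suppose that ψ_{kl} = 0 for every k < i and every l ∈ {1,…,n}, that ψ_{il} = 0 for every l < j, and that ψ_{ij} < 0. Then Σ_{k>i} Σ_{l>j} max(−ψ_{kl}, 0) ≥ −ψ_{ij}. -/
open Matrix Finset

/-- If a function with total sum zero vanishes strictly below `i`, then its sum strictly above `i`
is the negative of its value at `i`. -/
theorem sum_filter_lt_eq_neg {ι M : Type*} [Fintype ι] [LinearOrder ι] [AddCommGroup M] (f : ι → M)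
    (i : ι) (hsum : ∑ k, f k = 0) (hf : ∀ k < i, f k = 0) :
    ∑ k ∈ univ.filter (fun k => i < k), f k = -f i := by
  rw [eq_neg_iff_add_eq_zero, add_comm, ← sum_insert (by simp), ← hsum]
  refine sum_subset (subset_univ _) fun k _ hk => hf k ?_
  simp only [mem_insert, mem_filter, mem_univ, true_and, not_or, not_lt] at hk
  exact lt_of_le_of_ne hk.2 hk.1

/-- If all row and column sums of `Ψ` vanish, all entries preceding position
`(i, j)` in the row-by-row sweeping order vanish, and `ψ_{ij} < 0`, then the sum
of the positive parts of the negated entries in the lower-right block strictly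
below row `i` and strictly right of column `j` is at least `−ψ_{ij}`. -/
theorem sum_negPart_lowerRight_ge (n : ℕ) (Ψ : Matrix (Fin n) (Fin n) ℝ)
    (hrow : ∀ k, ∑ l, Ψ k l = 0) (hcol : ∀ l, ∑ k, Ψ k l = 0)
    (i j : Fin n) (hi : (i : ℕ) + 1 < n) (hj : (j : ℕ) + 1 < n)
    (hprevRows : ∀ k l : Fin n, k < i → Ψ k l = 0)
    (hprevInRow : ∀ l : Fin n, l < j → Ψ i l = 0)
    (hneg : Ψ i j < 0) :
    -Ψ i j ≤ ∑ k ∈ univ.filter (fun k => i < k),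
      ∑ l ∈ univ.filter (fun l => j < l), max (-Ψ k l) 0 := by
  calc
    -Ψ i j = ∑ l ∈ univ.filter (fun l => j < l), Ψ i l :=
      (sum_filter_lt_eq_neg (Ψ i) j (hrow i) hprevInRow).symm
    _ = ∑ l ∈ univ.filter (fun l => j < l), ∑ k ∈ univ.filter (fun k => i < k), -Ψ k l := by
      refine sum_congr rfl fun l _ => ?_
      rw [sum_neg_distrib, sum_filter_lt_eq_neg (fun k => Ψ k l) i (hcol l)
        fun k hk => hprevRows k l hk, neg_neg]
    _ = ∑ k ∈ univ.filter (fun k => i < k), ∑ l ∈ univ.filter (fun l => j < l), -Ψ k l :=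
      sum_comm
    _ ≤ _ := sum_le_sum fun k _ => sum_le_sum fun l _ => le_max_left _ _
end

section
/- Let Ψ = (ψ_{kl}) be an n×n real matrix all of whose row sums and all of whose column sums equal zero. Fix i, j ∈ {1,…,n−1} and suppose that ψ_{kl} = 0 for every k < i and every l ∈ {1,…,n}, that ψ_{il} = 0 for every l < j, and that ψ_{ij} > 0. Then there exist real numbers u_{kl} for i < k ≤ n and j < l ≤ n satisfying 0 ≤ u_{kl} ≤ max(ψ_{kl}, 0) for all such (k,l) and Σ_{k>i} Σ_{l>j} u_{kl} = ψ_{ij}. -/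
open Matrix Finset

/-- A finite sum whose terms before `i` vanish splits off the `i`-th term. -/
theorem sum_eq_add_sum_filter_lt_of_forall_lt_eq_zero {ι M : Type*} [Fintype ι] [LinearOrder ι]
    [AddCommMonoid M] (f : ι → M) (i : ι) (hf : ∀ k < i, f k = 0) :
    ∑ k, f k = f i + ∑ k ∈ univ.filter (fun k => i < k), f k := by
  rw [← sum_insert (by simp)]
  refine (sum_subset (subset_univ _) fun k _ hk => hf k ?_).symm
  simp only [mem_insert, mem_filter, mem_univ, true_and, not_or, not_lt] at hk
  exact lt_of_le_of_ne hk.2 hk.1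

/-- If all row and column sums of `Ψ` vanish, all entries preceding position
`(i, j)` in the row-by-row sweeping order vanish, and `ψ_{ij} > 0`, then there
exist nonnegative amounts `u_{kl} ≤ max(ψ_{kl}, 0)` for `k > i`, `l > j` whose
total is exactly `ψ_{ij}`. -/
theorem exists_redistribution_amounts (n : ℕ) (Ψ : Matrix (Fin n) (Fin n) ℝ)
    (hrow : ∀ k, ∑ l, Ψ k l = 0) (hcol : ∀ l, ∑ k, Ψ k l = 0)
    (i j : Fin n) (hi : (i : ℕ) + 1 < n) (hj : (j : ℕ) + 1 < n)
    (hprevRows : ∀ k l : Fin n, k < i → Ψ k l = 0)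
    (hprevInRow : ∀ l : Fin n, l < j → Ψ i l = 0)
    (hpos : 0 < Ψ i j) :
    ∃ u : Fin n → Fin n → ℝ,
      (∀ k l : Fin n, i < k → j < l → 0 ≤ u k l ∧ u k l ≤ max (Ψ k l) 0) ∧
      ∑ k ∈ univ.filter (fun k => i < k),
        ∑ l ∈ univ.filter (fun l => j < l), u k l = Ψ i j := by
  have hcol_tail (l : Fin n) : ∑ k ∈ univ.filter (fun k => i < k), Ψ k l = -Ψ i l := by
    have h := sum_eq_add_sum_filter_lt_of_forall_lt_eq_zero (fun k => Ψ k l) i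
      fun k hk => hprevRows k l hk
    rw [hcol l] at h
    linarith
  have hblock : ∑ k ∈ univ.filter (fun k => i < k),
      ∑ l ∈ univ.filter (fun l => j < l), Ψ k l = Ψ i j := by
    have h := sum_eq_add_sum_filter_lt_of_forall_lt_eq_zero (Ψ i) j hprevInRow
    rw [hrow i] at h
    refine sum_comm.trans ?_
    rw [sum_congr rfl fun l _ => hcol_tail l, sum_neg_distrib]
    linarith
  set S := ∑ k ∈ univ.filter (fun k => i < k),
    ∑ l ∈ univ.filter (fun l => j < l), max (Ψ k l) 0 with hS
  have hle : Ψ i j ≤ S := by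
    rw [← hblock]
    exact sum_le_sum fun k _ => sum_le_sum fun l _ => le_max_left _ _
  have hSpos : 0 < S := hpos.trans_le hle
  refine ⟨fun k l => Ψ i j / S * max (Ψ k l) 0, fun k l _ _ => ⟨by positivity, ?_⟩, ?_⟩
  · exact mul_le_of_le_one_left (le_max_right _ _) ((div_le_one hSpos).2 hle)
  · simp only [← mul_sum]
    rw [← hS, div_mul_cancel₀ _ hSpos.ne']
end

section
/- Fix a,b ∈ {1,2} and n ≥ 1. Let M₁ and M₂ be n×n real matrices with nonnegative entries such that every row sum of M₁ equals the corresponding row sum of M₂ and every column sum of M₁ equals the corresponding column sum of M₂. Assume the total weight τ is positive and the weighted standard deviations σ_src^{(a)} and σ_trg^{(b)} (which depend only on the row and column sums, hence are common to M₁ and M₂) are positive. Then for every θ ∈ [0,1], the matrix θM₁ + (1−θ)M₂ has the same row and column sums and satisfies r_{θM₁+(1−θ)M₂}(a,b) = θ·r_{M₁}(a,b) + (1−θ)·r_{M₂}(a,b); that is, the directed assortativity coefficient is an affine function of the edge weights on the set of nonnegative matrices with prescribed row and column sums. -/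
open Matrix Finset

/-- The `a`-strength of node `i` in a weighted directed network with adjacency
matrix `M`: the out-strength (row sum) if `a = 1`, the in-strength (column sum)
if `a = 2`. -/
noncomputable def str {n : ℕ} (M : Matrix (Fin n) (Fin n) ℝ) (a : ℕ) (i : Fin n) : ℝ :=
  if a = 1 then ∑ j, M i j else ∑ j, M j i

/-- Total edge weight `τ = Σ_{i,j} m_{ij}`. -/
noncomputable def tau {n : ℕ} (M : Matrix (Fin n) (Fin n) ℝ) : ℝ :=
  ∑ i, ∑ j, M i j

/-- Weighted mean of the `a`-strength of source nodes. -/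
noncomputable def sbarSrc {n : ℕ} (M : Matrix (Fin n) (Fin n) ℝ) (a : ℕ) : ℝ :=
  (∑ i, ∑ j, M i j * str M a i) / tau M

/-- Weighted mean of the `b`-strength of target nodes. -/
noncomputable def sbarTrg {n : ℕ} (M : Matrix (Fin n) (Fin n) ℝ) (b : ℕ) : ℝ :=
  (∑ i, ∑ j, M i j * str M b j) / tau M

/-- Weighted standard deviation of the `a`-strength of source nodes. -/
noncomputable def sigmaSrc {n : ℕ} (M : Matrix (Fin n) (Fin n) ℝ) (a : ℕ) : ℝ :=
  Real.sqrt ((∑ i, ∑ j, M i j * (str M a i - sbarSrc M a) ^ 2) / tau M)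

/-- Weighted standard deviation of the `b`-strength of target nodes. -/
noncomputable def sigmaTrg {n : ℕ} (M : Matrix (Fin n) (Fin n) ℝ) (b : ℕ) : ℝ :=
  Real.sqrt ((∑ i, ∑ j, M i j * (str M b j - sbarTrg M b) ^ 2) / tau M)

/-- The directed assortativity coefficient `r_M(a, b)`. -/
noncomputable def assortativity {n : ℕ} (M : Matrix (Fin n) (Fin n) ℝ) (a b : ℕ) : ℝ :=
  (∑ i, ∑ j, M i j * ((str M a i - sbarSrc M a) * (str M b j - sbarTrg M b))) /
    (tau M * sigmaSrc M a * sigmaTrg M b)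

section SameMarginals

variable {n : ℕ} {M N : Matrix (Fin n) (Fin n) ℝ}

theorem str_congr (hrow : ∀ i, ∑ j, M i j = ∑ j, N i j)
    (hcol : ∀ j, ∑ i, M i j = ∑ i, N i j) (a : ℕ) : str M a = str N a := by
  funext i
  simp only [str, hrow, hcol]

theorem tau_congr (hrow : ∀ i, ∑ j, M i j = ∑ j, N i j) : tau M = tau N := by
  simp only [tau, hrow]

theorem sum_mul_source_congr (hrow : ∀ i, ∑ j, M i j = ∑ j, N i j) (f : Fin n → ℝ) :
    ∑ i, ∑ j, M i j * f i = ∑ i, ∑ j, N i j * f i := by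
  simp only [← Finset.sum_mul, hrow]

theorem sum_mul_target_congr (hcol : ∀ j, ∑ i, M i j = ∑ i, N i j) (f : Fin n → ℝ) :
    ∑ i, ∑ j, M i j * f j = ∑ i, ∑ j, N i j * f j := by
  rw [Finset.sum_comm, Finset.sum_comm (f := fun i j => N i j * f j)]
  simp only [← Finset.sum_mul, hcol]

theorem sbarSrc_congr (hrow : ∀ i, ∑ j, M i j = ∑ j, N i j)
    (hcol : ∀ j, ∑ i, M i j = ∑ i, N i j) (a : ℕ) : sbarSrc M a = sbarSrc N a := by
  rw [sbarSrc, sbarSrc, tau_congr hrow, str_congr hrow hcol, sum_mul_source_congr hrow]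

theorem sbarTrg_congr (hrow : ∀ i, ∑ j, M i j = ∑ j, N i j)
    (hcol : ∀ j, ∑ i, M i j = ∑ i, N i j) (b : ℕ) : sbarTrg M b = sbarTrg N b := by
  rw [sbarTrg, sbarTrg, tau_congr hrow, str_congr hrow hcol, sum_mul_target_congr hcol]

theorem sigmaSrc_congr (hrow : ∀ i, ∑ j, M i j = ∑ j, N i j)
    (hcol : ∀ j, ∑ i, M i j = ∑ i, N i j) (a : ℕ) : sigmaSrc M a = sigmaSrc N a := by
  rw [sigmaSrc, sigmaSrc, tau_congr hrow, str_congr hrow hcol, sbarSrc_congr hrow hcol,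
    sum_mul_source_congr hrow fun i => (str N a i - sbarSrc N a) ^ 2]

theorem sigmaTrg_congr (hrow : ∀ i, ∑ j, M i j = ∑ j, N i j)
    (hcol : ∀ j, ∑ i, M i j = ∑ i, N i j) (b : ℕ) : sigmaTrg M b = sigmaTrg N b := by
  rw [sigmaTrg, sigmaTrg, tau_congr hrow, str_congr hrow hcol, sbarTrg_congr hrow hcol,
    sum_mul_target_congr hcol fun j => (str N b j - sbarTrg N b) ^ 2]

/-- The assortativity of `M`, with every term depending only on the row and column sums computed
from a matrix `N` with the same row and column sums. -/
theorem assortativity_eq_of_sums_eq (hrow : ∀ i, ∑ j, M i j = ∑ j, N i j)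
    (hcol : ∀ j, ∑ i, M i j = ∑ i, N i j) (a b : ℕ) :
    assortativity M a b =
      (∑ i, ∑ j, M i j * ((str N a i - sbarSrc N a) * (str N b j - sbarTrg N b))) /
        (tau N * sigmaSrc N a * sigmaTrg N b) := by
  rw [assortativity, tau_congr hrow, str_congr hrow hcol, str_congr hrow hcol,
    sbarSrc_congr hrow hcol, sbarTrg_congr hrow hcol, sigmaSrc_congr hrow hcol,
    sigmaTrg_congr hrow hcol]

end SameMarginals

/-- On the set of nonnegative matrices with prescribed row and column sums, the
directed assortativity coefficient is an affine function of the edge weights: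
for nonnegative `M₁`, `M₂` with equal row sums and equal column sums, positive
total weight, and positive (common) weighted standard deviations, every convex
combination `θ • M₁ + (1 − θ) • M₂` has the same row and column sums and its
assortativity is the corresponding affine combination. -/
theorem assortativity_affine (n : ℕ) (hn : 1 ≤ n)
    (a b : ℕ) (ha : a ∈ ({1, 2} : Set ℕ)) (hb : b ∈ ({1, 2} : Set ℕ))
    (M₁ M₂ : Matrix (Fin n) (Fin n) ℝ)
    (hM₁ : ∀ p q, 0 ≤ M₁ p q) (hM₂ : ∀ p q, 0 ≤ M₂ p q)
    (hrow : ∀ i, ∑ j, M₁ i j = ∑ j, M₂ i j)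
    (hcol : ∀ j, ∑ i, M₁ i j = ∑ i, M₂ i j)
    (htau : 0 < tau M₁)
    (hsrc : 0 < sigmaSrc M₁ a) (htrg : 0 < sigmaTrg M₁ b) :
    ∀ θ : ℝ, θ ∈ Set.Icc (0 : ℝ) 1 →
      (∀ i, ∑ j, (θ • M₁ + (1 - θ) • M₂) i j = ∑ j, M₁ i j) ∧
      (∀ j, ∑ i, (θ • M₁ + (1 - θ) • M₂) i j = ∑ i, M₁ i j) ∧
      assortativity (θ • M₁ + (1 - θ) • M₂) a b =
        θ * assortativity M₁ a b + (1 - θ) * assortativity M₂ a b := by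
  intro θ _
  have hrow' : ∀ i, ∑ j, (θ • M₁ + (1 - θ) • M₂) i j = ∑ j, M₁ i j := fun i => by
    simp only [Matrix.add_apply, Matrix.smul_apply, smul_eq_mul, Finset.sum_add_distrib,
      ← Finset.mul_sum, ← hrow]
    ring
  have hcol' : ∀ j, ∑ i, (θ • M₁ + (1 - θ) • M₂) i j = ∑ i, M₁ i j := fun j => by
    simp only [Matrix.add_apply, Matrix.smul_apply, smul_eq_mul, Finset.sum_add_distrib,
      ← Finset.mul_sum, ← hcol]
    ring
  refine ⟨hrow', hcol', ?_⟩
  rw [assortativity_eq_of_sums_eq hrow' hcol',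
    assortativity_eq_of_sums_eq (fun i => (hrow i).symm) (fun j => (hcol j).symm), assortativity]
  simp only [Matrix.add_apply, Matrix.smul_apply, smul_eq_mul, add_mul, mul_assoc θ,
    mul_assoc (1 - θ), Finset.sum_add_distrib, ← Finset.mul_sum]
  ring
end
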